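/- Suppose N ≥ 2 is an integer, δ, μ > 0 satisfy condition (H₁), 2N/(N+1) < p ≤ 2 and 2N/(N+1) < q ≤ 2, and 1/(δ+1) + 1/(μ+1) > (N − m)/(N(m−1)) where m = min{p,q}. Then there exists no radial ground state: there is no pair (u,v) of real functions on [0,∞), continuously differentiable on [0,∞) and twice continuously differentiable on (0,∞), with u(r) > 0 and v(r) > 0 for all r ≥ 0, u'(0) = v'(0) = 0, satisfying for all r > 0: (r^{N−1}|u'(r)|^{p−2}u'(r))' = −r^{N−1} v(r)^δ and (r^{N−1}|v'(r)|^{q−2}v'(r))' = −r^{N−1} u(r)^μ. -/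

import Mathlib

/-- A radial ground state of system (S_∞) on `[0,∞)`. -/
def IsGroundState (N : ℕ) (p q δ μ : ℝ) (u v : ℝ → ℝ) : Prop :=
  ContDiffOn ℝ 1 u (Set.Ici 0) ∧ ContDiffOn ℝ 1 v (Set.Ici 0) ∧
  ContDiffOn ℝ 2 u (Set.Ioi 0) ∧ ContDiffOn ℝ 2 v (Set.Ioi 0) ∧
  (∀ r : ℝ, 0 ≤ r → 0 < u r) ∧ (∀ r : ℝ, 0 ≤ r → 0 < v r) ∧
  deriv u 0 = 0 ∧ deriv v 0 = 0 ∧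
  (∀ r : ℝ, 0 < r →
    deriv (fun s => s ^ ((N:ℝ) - 1) * |deriv u s| ^ (p - 2) * deriv u s) r
      = -(r ^ ((N:ℝ) - 1) * v r ^ δ)) ∧
  (∀ r : ℝ, 0 < r →
    deriv (fun s => s ^ ((N:ℝ) - 1) * |deriv v s| ^ (q - 2) * deriv v s) r
      = -(r ^ ((N:ℝ) - 1) * u r ^ μ))

open Set Filter Topology

theorem monotoneOn_Ioi_of_hasDerivAt {g g' : ℝ → ℝ} (hg : ∀ r, 0 < r → HasDerivAt g (g' r) r)
    (hg' : ∀ r, 0 < r → 0 ≤ g' r) : MonotoneOn g (Ioi 0) := by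
  refine monotoneOn_of_deriv_nonneg (convex_Ioi 0)
    (fun r hr => (hg r hr).continuousAt.continuousWithinAt) ?_ ?_
  · exact fun r hr => (hg r (interior_subset hr)).differentiableAt.differentiableWithinAt
  · intro r hr
    rw [(hg r (interior_subset hr)).deriv]
    exact hg' r (interior_subset hr)

theorem strictMonoOn_Ioi_of_hasDerivAt {g g' : ℝ → ℝ} (hg : ∀ r, 0 < r → HasDerivAt g (g' r) r)
    (hg' : ∀ r, 0 < r → 0 < g' r) : StrictMonoOn g (Ioi 0) := by
  refine strictMonoOn_of_deriv_pos (convex_Ioi 0)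
    (fun r hr => (hg r hr).continuousAt.continuousWithinAt) ?_
  intro r hr
  rw [(hg r (interior_subset hr)).deriv]
  exact hg' r (interior_subset hr)

theorem nonneg_of_monotoneOn_Ioi {g : ℝ → ℝ} (hg : MonotoneOn g (Ioi 0)) {C a : ℝ} (ha : 0 < a)
    (h : ∀ s, 0 < s → s ≤ 1 → -(C * s ^ a) ≤ g s) {r : ℝ} (hr : 0 < r) : 0 ≤ g r := by
  have hlim : Tendsto (fun s : ℝ => -(C * s ^ a)) (𝓝[>] 0) (𝓝 0) := by
    have : ContinuousAt (fun s : ℝ => -(C * s ^ a)) 0 :=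
      ((Real.continuousAt_rpow_const 0 a (Or.inr ha.le)).const_mul C).neg
    simpa [ContinuousAt, Real.zero_rpow ha.ne'] using this.mono_left nhdsWithin_le_nhds
  refine le_of_tendsto hlim ?_
  filter_upwards [Ioo_mem_nhdsGT (lt_min hr one_pos)] with s hs
  have hs' := lt_min_iff.1 hs.2
  exact (h s hs.1 hs'.2.le).trans (hg hs.1 hr hs'.1.le)

theorem pos_of_strictMonoOn_Ioi {g : ℝ → ℝ} (hg : StrictMonoOn g (Ioi 0)) {C a : ℝ} (ha : 0 < a)
    (h : ∀ s, 0 < s → s ≤ 1 → -(C * s ^ a) ≤ g s) {r : ℝ} (hr : 0 < r) : 0 < g r :=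
  (nonneg_of_monotoneOn_Ioi hg.monotoneOn ha h (half_pos hr)).trans_lt
    (hg (half_pos hr) hr (half_lt_self hr))

/-- A positive function `u` on `(0,∞)` with slope `-U < 0` which solves
`(r ^ (n - 1) * U ^ (p - 1))' = r ^ (n - 1) * v ^ δ`, and is bounded in `C¹` near `0`. -/
structure IsDecreasingSolution (n p δ : ℝ) (u U v : ℝ → ℝ) : Prop where
  pos : ∀ r, 0 < r → 0 < u r
  slope_pos : ∀ r, 0 < r → 0 < U r
  hasDerivAt : ∀ r, 0 < r → HasDerivAt u (-U r) r
  hasDerivAt_slope : ∀ r, 0 < r →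
    HasDerivAt U (v r ^ δ * U r ^ (2 - p) / (p - 1) - (n - 1) / (p - 1) * U r / r) r
  bounded : ∃ M, ∀ r, 0 < r → r ≤ 1 → u r ≤ M ∧ U r ≤ M

namespace IsDecreasingSolution

variable {n p q δ μ : ℝ} {u U v V : ℝ → ℝ}

theorem mul_slope_le (h : IsDecreasingSolution n p δ u U v) (hv : ∀ r, 0 < r → 0 < v r)
    (hp : 1 < p) {r : ℝ} (hr : 0 < r) (hn : p ≤ n) :
    r * U r ≤ ((n - 1) / (p - 1) - 1) * u r := by
  by_contra! hlt
  set k := (n - 1) / (p - 1) with hk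
  have hk1 : 0 ≤ k - 1 := by
    rw [hk, sub_nonneg, le_div_iff₀ (by linarith)]; linarith
  have hp0 : 0 < p - 1 := by linarith
  have hmono : MonotoneOn (fun s => s * U s - (k - 1) * u s) (Ioi 0) := by
    refine monotoneOn_Ioi_of_hasDerivAt
      (g' := fun s => s * (v s ^ δ * U s ^ (2 - p) / (p - 1))) (fun s hs => ?_) (fun s hs => ?_)
    · refine (((hasDerivAt_id' s).fun_mul (h.hasDerivAt_slope s hs)).fun_sub
        ((h.hasDerivAt s hs).const_mul (k - 1))).congr_deriv ?_
      simp only [← hk]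
      field_simp
      ring
    · have := hv s hs
      have := h.slope_pos s hs
      positivity
  set c := r * U r - (k - 1) * u r with hc
  have hc0 : 0 < c := by linarith
  have hanti : ∀ s, r ≤ s → u s + c * Real.log s ≤ u r + c * Real.log r := by
    have : AntitoneOn (fun s => u s + c * Real.log s) (Ici r) := by
      refine antitoneOn_of_deriv_nonpos (convex_Ici r) (fun s hs => ?_) (fun s hs => ?_)
        (fun s hs => ?_)
      · have hs0 : 0 < s := hr.trans_le hs
        exact ((h.hasDerivAt s hs0).continuousAt.add
          ((Real.continuousAt_log hs0.ne').const_mul c)).continuousWithinAt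
      · rw [interior_Ici] at hs
        have hs0 : 0 < s := hr.trans hs
        exact ((h.hasDerivAt s hs0).add
          ((Real.hasDerivAt_log hs0.ne').const_mul c)).differentiableAt.differentiableWithinAt
      · rw [interior_Ici] at hs
        have hs0 : 0 < s := hr.trans hs
        rw [((h.hasDerivAt s hs0).fun_add ((Real.hasDerivAt_log hs0.ne').const_mul c)).deriv]
        have h1 := hmono hr hs0 (le_of_lt hs)
        have h2 := mul_nonneg hk1 (h.pos s hs0).le
        simp only at h1
        have h3 : c * s⁻¹ ≤ U s := by
          rw [← div_eq_mul_inv, div_le_iff₀ hs0]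
          linarith
        linarith
    exact fun s hs => this self_mem_Ici hs hs
  have hlim : Tendsto (fun s => c * Real.log s) atTop atTop :=
    Real.tendsto_log_atTop.const_mul_atTop hc0
  obtain ⟨s, hs1, hs2⟩ :=
    ((hlim.eventually_gt_atTop (u r + c * Real.log r)).and (eventually_ge_atTop r)).exists
  linarith [hanti s hs2, h.pos s (hr.trans_le hs2)]

theorem mul_rpow_le (h : IsDecreasingSolution n p δ u U v) (h' : IsDecreasingSolution n q μ v V u)
    (hp : 1 < p) (hn : 1 < n) (hδ : 0 < δ) {r : ℝ} (hr : 0 < r) :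
    r * v r ^ δ ≤ n * U r ^ (p - 1) := by
  have hp0 : 0 < p - 1 := by linarith
  obtain ⟨M, hM⟩ := h'.bounded
  have hmono : MonotoneOn
      (fun s => n * (s ^ (n - 1) * U s ^ (p - 1)) - s ^ n * v s ^ δ) (Ioi 0) := by
    refine monotoneOn_Ioi_of_hasDerivAt
      (g' := fun s => s ^ n * (V s * (δ * v s ^ (δ - 1)))) (fun s hs => ?_) (fun s hs => ?_)
    · have hU := h.slope_pos s hs
      have hv := h'.pos s hs
      refine ((((Real.hasDerivAt_rpow_const (p := n - 1) (Or.inl hs.ne')).fun_mul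
        ((h.hasDerivAt_slope s hs).rpow_const (p := p - 1) (Or.inl hU.ne'))).const_mul n).fun_sub
        ((Real.hasDerivAt_rpow_const (p := n) (Or.inl hs.ne')).fun_mul
        ((h'.hasDerivAt s hs).rpow_const (p := δ) (Or.inl hv.ne')))).congr_deriv ?_
      have e1 : s ^ n = s ^ (n - 1) * s := by
        rw [← Real.rpow_add_one hs.ne']; congr 1; ring
      have e2 : s ^ (n - 1) = s ^ (n - 1 - 1) * s := by
        rw [← Real.rpow_add_one hs.ne']; congr 1; ring
      have e3 : U s ^ (p - 1) = U s ^ (p - 1 - 1) * U s := by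
        rw [← Real.rpow_add_one hU.ne']; congr 1; ring
      have e4 : U s ^ (2 - p) * U s ^ (p - 1 - 1) = 1 := by
        rw [← Real.rpow_add hU]; ring_nf; simp
      have e5 : v s ^ δ * U s ^ (2 - p) / (p - 1) * (p - 1) * U s ^ (p - 1 - 1) = v s ^ δ := by
        field_simp
        exact e4
      rw [e1, e3]
      have e6 : (v s ^ δ * U s ^ (2 - p) / (p - 1) - (n - 1) / (p - 1) * U s / s) * (p - 1)
          * U s ^ (p - 1 - 1) = v s ^ δ - (n - 1) * (U s ^ (p - 1 - 1) * U s) / s := by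
        rw [sub_mul, sub_mul, e5]
        field_simp
      rw [e6, e2]
      field_simp
      ring
    · have := h'.pos s hs
      have := h'.slope_pos s hs
      positivity
  have key := nonneg_of_monotoneOn_Ioi hmono (C := M ^ δ) (a := n) (by linarith)
    (fun s hs hs1 => by
      have hU := h.slope_pos s hs
      have hv := h'.pos s hs
      have h1 : v s ^ δ ≤ M ^ δ := Real.rpow_le_rpow hv.le (hM s hs hs1).1 hδ.le
      have h2 : s ^ n * v s ^ δ ≤ s ^ n * M ^ δ := by gcongr
      have h3 : 0 ≤ n * (s ^ (n - 1) * U s ^ (p - 1)) := by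
        have : 0 < n := by linarith
        positivity
      linarith) hr
  have e1 : r ^ n = r ^ (n - 1) * r := by
    rw [← Real.rpow_add_one hr.ne']; congr 1; ring
  rw [e1] at key
  have h0 : 0 < r ^ (n - 1) := by positivity
  refine le_of_mul_le_mul_left ?_ h0
  linarith

theorem exists_rpow_le (h : IsDecreasingSolution n p δ u U v)
    (h' : IsDecreasingSolution n q μ v V u)
    (hp : 1 < p) (hn1 : 1 < n) (hn : p ≤ n) (hδ : 0 < δ) :
    ∃ K, 0 < K ∧ ∀ r, 0 < r → v r ^ δ ≤ K * (r ^ (-p) * u r ^ (p - 1)) := by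
  have hp0 : 0 < p - 1 := by linarith
  set k := (n - 1) / (p - 1) with hk
  have hk1 : 0 ≤ k - 1 := by
    rw [hk, sub_nonneg, le_div_iff₀ (by linarith)]; linarith
  refine ⟨n * (k - 1) ^ (p - 1) + 1, by positivity, fun r hr => ?_⟩
  have hU := h.slope_pos r hr
  have hu := h.pos r hr
  have h1 := h.mul_rpow_le h' hp hn1 hδ hr
  have h2 := Real.rpow_le_rpow (by positivity) (h.mul_slope_le h'.pos hp hr hn) hp0.le
  rw [← hk, Real.mul_rpow hr.le hU.le, Real.mul_rpow hk1 hu.le] at h2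
  have e1 : r ^ (p - 1) * r * r ^ (-p) = 1 := by
    rw [← Real.rpow_add_one hr.ne', ← Real.rpow_add hr]; ring_nf; simp
  have hn0 : 0 < n := by linarith
  calc v r ^ δ = r ^ (-p) * (r ^ (p - 1) * (r * v r ^ δ)) := by linear_combination -(v r ^ δ) * e1
    _ ≤ r ^ (-p) * (r ^ (p - 1) * (n * U r ^ (p - 1))) := by gcongr
    _ = r ^ (-p) * (n * (r ^ (p - 1) * U r ^ (p - 1))) := by ring
    _ ≤ r ^ (-p) * (n * ((k - 1) ^ (p - 1) * u r ^ (p - 1))) := by gcongr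
    _ = n * (k - 1) ^ (p - 1) * (r ^ (-p) * u r ^ (p - 1)) := by ring
    _ ≤ _ := by gcongr; linarith

theorem exists_source_le (h : IsDecreasingSolution n p δ u U v)
    (h' : IsDecreasingSolution n q μ v V u)
    (hp : 1 < p) (hp2 : p ≤ 2) (hn1 : 1 < n) (hn : p ≤ n) (hδ : 0 < δ) :
    ∃ K, 0 < K ∧ ∀ r, 0 < r → v r ^ δ * U r ^ (2 - p) / (p - 1) ≤ K * (u r / r ^ 2) := by
  have hp0 : 0 < p - 1 := by linarith
  obtain ⟨K, hK, hle⟩ := h.exists_rpow_le h' hp hn1 hn hδ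
  set k := (n - 1) / (p - 1) with hk
  have hk1 : 0 ≤ k - 1 := by
    rw [hk, sub_nonneg, le_div_iff₀ (by linarith)]; linarith
  refine ⟨K * (k - 1) ^ (2 - p) / (p - 1) + 1, by positivity, fun r hr => ?_⟩
  have hU := h.slope_pos r hr
  have hu := h.pos r hr
  have h1 : U r ≤ (k - 1) * (u r / r) := by
    rw [← mul_div_assoc, le_div_iff₀ hr, mul_comm]
    exact h.mul_slope_le h'.pos hp hr hn
  have h2 : U r ^ (2 - p) ≤ (k - 1) ^ (2 - p) * (u r ^ (2 - p) / r ^ (2 - p)) := by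
    rw [← Real.div_rpow hu.le hr.le, ← Real.mul_rpow hk1 (by positivity)]
    exact Real.rpow_le_rpow hU.le h1 (by linarith)
  have e1 : u r ^ (p - 1) * u r ^ (2 - p) = u r := by
    rw [← Real.rpow_add hu]; ring_nf; simp
  have e2 : r ^ (-p) / r ^ (2 - p) = 1 / r ^ 2 := by
    rw [← Real.rpow_sub hr, ← Real.rpow_natCast, one_div, ← Real.rpow_neg hr.le]
    congr 1; push_cast; ring
  calc v r ^ δ * U r ^ (2 - p) / (p - 1)
      ≤ (K * (r ^ (-p) * u r ^ (p - 1)))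
        * ((k - 1) ^ (2 - p) * (u r ^ (2 - p) / r ^ (2 - p))) / (p - 1) := by
        gcongr
        exact hle r hr
    _ = K * (k - 1) ^ (2 - p) / (p - 1) *
        ((u r ^ (p - 1) * u r ^ (2 - p)) * (r ^ (-p) / r ^ (2 - p))) := by ring
    _ = K * (k - 1) ^ (2 - p) / (p - 1) * (u r / r ^ 2) := by rw [e1, e2]; ring
    _ ≤ _ := by gcongr; linarith

theorem exists_le_rpow (h : IsDecreasingSolution n p δ u U v)
    (h' : IsDecreasingSolution n q μ v V u) (hp : 1 < p) (hq : 1 < q) (hn1 : 1 < n)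
    (hpn : p ≤ n) (hqn : q ≤ n) (hδ : 0 < δ) (hμ : 0 < μ) {D : ℝ}
    (hD : D = δ * μ - (p - 1) * (q - 1)) (hD0 : 0 < D) :
    ∃ K, 0 < K ∧ ∀ r, 0 < r → u r ≤ K * r ^ (-((p * (q - 1) + q * δ) / D)) := by
  obtain ⟨A, hA, hvA⟩ := h.exists_rpow_le h' hp hn1 hpn hδ
  obtain ⟨B, hB, huB⟩ := h'.exists_rpow_le h hq hn1 hqn hμ
  refine ⟨(B ^ δ * A ^ (q - 1)) ^ D⁻¹, by positivity, fun r hr => ?_⟩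
  have hu := h.pos r hr
  have hv := h'.pos r hr
  have h1 := Real.rpow_le_rpow (by positivity) (huB r hr) hδ.le
  have h2 := Real.rpow_le_rpow (by positivity) (hvA r hr) (sub_pos.2 hq).le
  rw [Real.mul_rpow hB.le (by positivity), Real.mul_rpow (by positivity) (by positivity),
    ← Real.rpow_mul hr.le, ← Real.rpow_mul hu.le, ← Real.rpow_mul hv.le] at h1
  rw [Real.mul_rpow hA.le (by positivity), Real.mul_rpow (by positivity) (by positivity),
    ← Real.rpow_mul hr.le, ← Real.rpow_mul hu.le, ← Real.rpow_mul hv.le] at h2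
  have h3 : u r ^ D ≤ (B ^ δ * A ^ (q - 1)) * r ^ (-(p * (q - 1) + q * δ)) := by
    have e1 : u r ^ (μ * δ) = u r ^ D * u r ^ ((p - 1) * (q - 1)) := by
      rw [← Real.rpow_add hu]; congr 1; rw [hD]; ring
    have e2 : r ^ (-(p * (q - 1) + q * δ)) = r ^ (-q * δ) * r ^ (-p * (q - 1)) := by
      rw [← Real.rpow_add hr]; congr 1; ring
    have h0 : 0 < u r ^ ((p - 1) * (q - 1)) := by positivity
    refine le_of_mul_le_mul_right ?_ h0
    rw [← e1, e2]
    refine h1.trans ?_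
    rw [mul_comm δ (q - 1)] at h2
    calc B ^ δ * (r ^ (-q * δ) * v r ^ ((q - 1) * δ))
        ≤ B ^ δ * (r ^ (-q * δ) *
          (A ^ (q - 1) * (r ^ (-p * (q - 1)) * u r ^ ((p - 1) * (q - 1))))) := by gcongr
      _ = _ := by ring
  have h4 := Real.rpow_le_rpow (by positivity) h3 (inv_pos.2 hD0).le
  rw [Real.mul_rpow (by positivity) (by positivity), ← Real.rpow_mul hu.le, ← Real.rpow_mul hr.le,
    mul_inv_cancel₀ hD0.ne', Real.rpow_one] at h4
  rwa [div_eq_mul_inv, ← neg_mul]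

theorem hasDerivAt_potential (h : IsDecreasingSolution n p δ u U v)
    (h' : IsDecreasingSolution n q μ v V u) (hp : 1 < p) (hδ : 0 < δ) (s : ℝ) {r : ℝ}
    (hr : 0 < r) :
    HasDerivAt (fun x => x ^ (s + 1) * (v x ^ (δ + 1) * U x ^ (2 - p) / ((p - 1) * (δ + 1))))
      (r ^ s * (-(r * (v r ^ δ * U r ^ (2 - p) / (p - 1)) * V r) +
        v r ^ δ * U r ^ (2 - p) / (p - 1) * v r / (δ + 1) *
          (s + 1 - (2 - p) * ((n - 1) / (p - 1)) +
            (2 - p) * r * (v r ^ δ * U r ^ (2 - p) / (p - 1)) / U r))) r := by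
  have hp0 : 0 < p - 1 := by linarith
  have hU := h.slope_pos r hr
  have hv := h'.pos r hr
  have hδ1 : 0 < δ + 1 := by linarith
  refine ((Real.hasDerivAt_rpow_const (p := s + 1) (Or.inl hr.ne')).fun_mul
    ((((h'.hasDerivAt r hr).rpow_const (p := δ + 1) (Or.inl hv.ne')).fun_mul
      ((h.hasDerivAt_slope r hr).rpow_const (p := 2 - p) (Or.inl hU.ne'))).div_const
        ((p - 1) * (δ + 1)))).congr_deriv ?_
  rw [add_sub_cancel_right, add_sub_cancel_right, Real.rpow_add_one hv.ne',
    Real.rpow_add_one hr.ne', Real.rpow_sub_one hU.ne']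
  field_simp
  ring

theorem hasDerivAt_mul_slope_mul (h : IsDecreasingSolution n p δ u U v)
    (h' : IsDecreasingSolution n q μ v V u) (s : ℝ) {r : ℝ} (hr : 0 < r) :
    HasDerivAt (fun x => x ^ s * (U x * v x))
      (r ^ s * (v r ^ δ * U r ^ (2 - p) / (p - 1) * v r
        + (s - (n - 1) / (p - 1)) * (U r * v r / r) - U r * V r)) r := by
  refine ((Real.hasDerivAt_rpow_const (p := s) (Or.inl hr.ne')).fun_mul
    ((h.hasDerivAt_slope r hr).fun_mul (h'.hasDerivAt r hr))).congr_deriv ?_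
  rw [Real.rpow_sub_one hr.ne']
  ring

theorem hasDerivAt_mul_slope_mul_slope (h : IsDecreasingSolution n p δ u U v)
    (h' : IsDecreasingSolution n q μ v V u) (s : ℝ) {r : ℝ} (hr : 0 < r) :
    HasDerivAt (fun x => x ^ (s + 1) * (U x * V x))
      (r ^ s * (r * (v r ^ δ * U r ^ (2 - p) / (p - 1)) * V r
        + r * (u r ^ μ * V r ^ (2 - q) / (q - 1)) * U r
        + (s + 1 - (n - 1) / (p - 1) - (n - 1) / (q - 1)) * (U r * V r))) r := by
  refine ((Real.hasDerivAt_rpow_const (p := s + 1) (Or.inl hr.ne')).fun_mul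
    ((h.hasDerivAt_slope r hr).fun_mul (h'.hasDerivAt_slope r hr))).congr_deriv ?_
  rw [add_sub_cancel_right, Real.rpow_add_one hr.ne']
  field_simp
  ring

/-- Below the critical hyperbola the two self-similar decay exponents have a large sum. -/
theorem lt_decay_exponents {D : ℝ} (hp : 1 < p) (hpq : p ≤ q) (hp2 : p ≤ 2) (hn : p ≤ n)
    (hδ : 0 < δ) (hμ : 0 < μ) (hD : D = δ * μ - (p - 1) * (q - 1)) (hD0 : 0 < D)
    (hineq : (n - p) / (n * (p - 1)) < 1 / (δ + 1) + 1 / (μ + 1)) :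
    (n - p) / (p - 1) < (p * (q - 1) + q * δ) / D + (q * (p - 1) + p * μ) / D := by
  have hp0 : 0 < p - 1 := by linarith
  have hq0 : 0 < q - 1 := by linarith
  have hn0 : 0 < n := by linarith
  have hq : 0 < q := by linarith
  set P := p * (q - 1) + q * δ with hP
  set Q := q * (p - 1) + p * μ with hQ
  have hP0 : 0 < P := by positivity
  have hQ0 : 0 < Q := by positivity
  set T := (p - 1) * (P + Q) + p * D with hT
  have hT0 : 0 < T := by positivity
  have h1 : T ≤ Q * (δ + 1) := by
    have : Q * (δ + 1) = (p - 1) * P + p * D + Q := by rw [hD, hP, hQ]; ring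
    rw [this, hT]
    nlinarith [mul_nonneg (sub_nonneg.2 hp2) hQ0.le]
  have h2 : T ≤ P * (μ + 1) := by
    have : P * (μ + 1) = (q - 1) * Q + q * D + P := by rw [hD, hP, hQ]; ring
    rw [this, hT]
    nlinarith [mul_nonneg (sub_nonneg.2 hp2) hP0.le, mul_nonneg (sub_nonneg.2 hpq) hQ0.le,
      mul_nonneg (sub_nonneg.2 hpq) hD0.le]
  have h3 : 1 / (δ + 1) ≤ Q / T := by
    rw [div_le_div_iff₀ (by linarith) hT0]; linarith
  have h4 : 1 / (μ + 1) ≤ P / T := by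
    rw [div_le_div_iff₀ (by linarith) hT0]; linarith
  have h5 : (n - p) / (n * (p - 1)) < (P + Q) / T := by rw [add_div]; linarith
  rw [div_lt_div_iff₀ (by positivity) hT0, hT] at h5
  rw [← add_div, div_lt_div_iff₀ hp0 hD0]
  have hpp : 0 < p := by linarith
  refine lt_of_mul_lt_mul_left ?_ hpp.le
  linarith

/-- A Pohozaev-type functional for the coupled system. -/
noncomputable def energy (p q δ μ l a b : ℝ) (u U v V : ℝ → ℝ) (x : ℝ) : ℝ :=
  x ^ (l + 1) * (U x * V x)
    + x ^ (l + 1) * (v x ^ (δ + 1) * U x ^ (2 - p) / ((p - 1) * (δ + 1)))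
    + x ^ (l + 1) * (u x ^ (μ + 1) * V x ^ (2 - q) / ((q - 1) * (μ + 1)))
    - a * (x ^ l * (U x * v x)) - b * (x ^ l * (V x * u x))

theorem strictMonoOn_energy {k l a b : ℝ} (h : IsDecreasingSolution n p δ u U v)
    (h' : IsDecreasingSolution n q μ v V u) (hp1 : 1 < p) (hq1 : 1 < q) (hp2 : p ≤ 2) (hq2 : q ≤ 2)
    (hδ : 0 < δ) (hμ : 0 < μ) (hk : (n - 1) / (p - 1) = k) (hl : (n - 1) / (q - 1) = l)
    (hl1 : 0 < l - 1) (hd : 0 ≤ k - l) (ha0 : 0 ≤ a)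
    (ha : a * (δ + 1) = n - (k - l)) (hb : b * (μ + 1) = n)
    (hcoef : 0 < (1 - k + a + b) * (l - 1) + a * (k - l)) :
    StrictMonoOn (energy p q δ μ l a b u U v V) (Ioi 0) := by
  have hp0 : 0 < p - 1 := by linarith
  have hq0 : 0 < q - 1 := by linarith
  refine strictMonoOn_Ioi_of_hasDerivAt (fun r hr =>
    (((((h.hasDerivAt_mul_slope_mul_slope h' l hr).fun_add
      (h.hasDerivAt_potential h' hp1 hδ l hr)).fun_add
        (h'.hasDerivAt_potential h hq1 hμ l hr)).fun_sub
      ((h.hasDerivAt_mul_slope_mul h' l hr).const_mul a)).fun_sub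
      ((h'.hasDerivAt_mul_slope_mul h l hr).const_mul b))) (fun r hr => ?_)
  have hU := h.slope_pos r hr
  have hV := h'.slope_pos r hr
  have hu := h.pos r hr
  have hv := h'.pos r hr
  have hF : 0 ≤ v r ^ δ * U r ^ (2 - p) / (p - 1) := by positivity
  have hG : 0 ≤ u r ^ μ * V r ^ (2 - q) / (q - 1) := by positivity
  have hpow : 0 < r ^ l := by positivity
  have hVv : r * V r ≤ (l - 1) * v r := by
    rw [← hl]
    refine h'.mul_slope_le h.pos hq1 hr ?_
    have : q - 1 ≤ n - 1 := by
      rw [← one_le_div hq0, hl]; linarith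
    linarith
  have e1 : l + 1 - (2 - p) * k = a * (δ + 1) := by
    rw [ha]; linear_combination (div_mul_cancel₀ (n - 1) hp0.ne') - hk * (p - 1)
  have e2 : l + 1 - (2 - q) * l = b * (μ + 1) := by
    rw [hb]; linear_combination (div_mul_cancel₀ (n - 1) hq0.ne') - hl * (q - 1)
  rw [hk, hl, e1, e2]
  generalize v r ^ δ * U r ^ (2 - p) / (p - 1) = F at hF ⊢
  generalize u r ^ μ * V r ^ (2 - q) / (q - 1) = G at hG ⊢
  have hcross : 0 < (1 - k + a + b) * (U r * V r) + a * (k - l) * (U r * v r / r) := by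
    have h1 : U r * V r ≤ (l - 1) * (U r * v r / r) := by
      rw [← mul_div_assoc, le_div_iff₀ hr]
      linarith [mul_le_mul_of_nonneg_left hVv hU.le]
    have h2 : 0 < ((1 - k + a + b) * (l - 1) + a * (k - l)) * (U r * V r) := by positivity
    have h3 : 0 ≤ a * (k - l) := by positivity
    refine lt_of_mul_lt_mul_left ?_ hl1.le
    linarith [mul_le_mul_of_nonneg_left h1 h3]
  have hp2' : 0 ≤ 2 - p := by linarith
  have hq2' : 0 ≤ 2 - q := by linarith
  have hrest : 0 ≤ (2 - p) * r * F / U r * (F * v r / (δ + 1))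
      + (2 - q) * r * G / V r * (G * u r / (μ + 1)) := by positivity
  refine (mul_pos hpow (add_pos_of_pos_of_nonneg hcross hrest)).trans_eq ?_
  have e3 : F * v r / (δ + 1) * (a * (δ + 1)) = a * (F * v r) := by field_simp
  have e4 : G * u r / (μ + 1) * (b * (μ + 1)) = b * (G * u r) := by field_simp
  linear_combination -(r ^ l) * (e3 + e4)

theorem exists_energy_lower {l a b : ℝ} (h : IsDecreasingSolution n p δ u U v)
    (h' : IsDecreasingSolution n q μ v V u) (hp1 : 1 < p) (hq1 : 1 < q) (hδ : 0 < δ) (hμ : 0 < μ)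
    (ha0 : 0 ≤ a) (hb0 : 0 ≤ b) :
    ∃ C, ∀ s, 0 < s → s ≤ 1 → -(C * s ^ l) ≤ energy p q δ μ l a b u U v V s := by
  have hp0 : 0 < p - 1 := by linarith
  have hq0 : 0 < q - 1 := by linarith
  obtain ⟨M, hM⟩ := h.bounded
  obtain ⟨M', hM'⟩ := h'.bounded
  refine ⟨a * (M * M') + b * (M' * M), fun s hs hs1 => ?_⟩
  have hU := h.slope_pos s hs
  have hV := h'.slope_pos s hs
  have hu := h.pos s hs
  have hv := h'.pos s hs
  obtain ⟨huM, hUM⟩ := hM s hs hs1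
  obtain ⟨hvM, hVM⟩ := hM' s hs hs1
  have hM0 := hU.le.trans hUM
  have hM0' := hV.le.trans hVM
  have h1 : a * (s ^ l * (U s * v s)) ≤ a * (s ^ l * (M * M')) := by gcongr
  have h2 : b * (s ^ l * (V s * u s)) ≤ b * (s ^ l * (M' * M)) := by gcongr
  have h3 : 0 ≤ s ^ (l + 1) * (U s * V s)
    + s ^ (l + 1) * (v s ^ (δ + 1) * U s ^ (2 - p) / ((p - 1) * (δ + 1)))
    + s ^ (l + 1) * (u s ^ (μ + 1) * V s ^ (2 - q) / ((q - 1) * (μ + 1))) := by positivity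
  unfold energy
  linarith

theorem exists_energy_le {l a b : ℝ} (h : IsDecreasingSolution n p δ u U v)
    (h' : IsDecreasingSolution n q μ v V u) (hp1 : 1 < p) (hq1 : 1 < q) (hp2 : p ≤ 2) (hq2 : q ≤ 2)
    (hn : 2 ≤ n) (hδ : 0 < δ) (hμ : 0 < μ) (ha0 : 0 ≤ a) (hb0 : 0 ≤ b) :
    ∃ c, 0 ≤ c ∧ ∀ r, 0 < r →
      energy p q δ μ l a b u U v V r ≤ c * (r ^ (l - 1) * (u r * v r)) := by
  have hp0 : 0 < p - 1 := by linarith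
  have hq0 : 0 < q - 1 := by linarith
  obtain ⟨K, hK, hFK⟩ := h.exists_source_le h' hp1 hp2 (by linarith) (by linarith) hδ
  obtain ⟨L, hL, hGL⟩ := h'.exists_source_le h hq1 hq2 (by linarith) (by linarith) hμ
  have hkp : 0 ≤ (n - 1) / (p - 1) - 1 := by
    rw [sub_nonneg, one_le_div hp0]; linarith
  have hkq : 0 ≤ (n - 1) / (q - 1) - 1 := by
    rw [sub_nonneg, one_le_div hq0]; linarith
  refine ⟨((n - 1) / (p - 1) - 1) * ((n - 1) / (q - 1) - 1) + K / (δ + 1) + L / (μ + 1),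
    by positivity, fun r hr => ?_⟩
  have hU := h.slope_pos r hr
  have hV := h'.slope_pos r hr
  have hu := h.pos r hr
  have hv := h'.pos r hr
  have er : r ^ (l + 1) = r ^ (l - 1) * (r * r) := by
    rw [← mul_assoc, ← Real.rpow_add_one hr.ne', ← Real.rpow_add_one hr.ne']; congr 1; ring
  have h1 : r ^ (l + 1) * (U r * V r) ≤ r ^ (l - 1) *
      ((((n - 1) / (p - 1) - 1) * u r) * (((n - 1) / (q - 1) - 1) * v r)) := by
    rw [er, mul_assoc, mul_mul_mul_comm]
    have := mul_le_mul (h.mul_slope_le h'.pos hp1 hr (by linarith))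
      (h'.mul_slope_le h.pos hq1 hr (by linarith)) (by positivity) (by positivity)
    gcongr
  have h2 : r ^ (l + 1) * (v r ^ (δ + 1) * U r ^ (2 - p) / ((p - 1) * (δ + 1)))
      ≤ r ^ (l - 1) * (K / (δ + 1) * (u r * v r)) := by
    calc _ = r ^ (l + 1) * (v r ^ δ * U r ^ (2 - p) / (p - 1) * (v r / (δ + 1))) := by
          rw [Real.rpow_add_one hv.ne']; field_simp
      _ ≤ r ^ (l + 1) * (K * (u r / r ^ 2) * (v r / (δ + 1))) := by
          gcongr; exact hFK r hr
      _ = _ := by rw [er]; field_simp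
  have h3 : r ^ (l + 1) * (u r ^ (μ + 1) * V r ^ (2 - q) / ((q - 1) * (μ + 1)))
      ≤ r ^ (l - 1) * (L / (μ + 1) * (u r * v r)) := by
    calc _ = r ^ (l + 1) * (u r ^ μ * V r ^ (2 - q) / (q - 1) * (u r / (μ + 1))) := by
          rw [Real.rpow_add_one hu.ne']; field_simp
      _ ≤ r ^ (l + 1) * (L * (v r / r ^ 2) * (u r / (μ + 1))) := by
          gcongr; exact hGL r hr
      _ = _ := by rw [er]; field_simp
  have h4 : 0 ≤ a * (r ^ l * (U r * v r)) := by positivity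
  have h5 : 0 ≤ b * (r ^ l * (V r * u r)) := by positivity
  unfold energy
  linarith

theorem false_of_subcritical (h : IsDecreasingSolution n p δ u U v)
    (h' : IsDecreasingSolution n q μ v V u) (hn : 2 ≤ n) (hδ : 0 < δ) (hμ : 0 < μ)
    (hD : 0 < δ * μ - (p - 1) * (q - 1)) (hp : 2 * n / (n + 1) < p) (hpq : p ≤ q) (hq2 : q ≤ 2)
    (hineq : (n - p) / (n * (p - 1)) < 1 / (δ + 1) + 1 / (μ + 1)) : False := by
  have hp1 : 1 < p := by
    refine lt_of_le_of_lt ?_ hp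
    rw [le_div_iff₀ (by linarith)]; linarith
  have hq1 : 1 < q := by linarith
  have hp0 : 0 < p - 1 := by linarith
  have hq0 : 0 < q - 1 := by linarith
  have hn0 : 0 < n := by linarith
  have hpn : p ≤ n := by linarith
  have hqn : q ≤ n := by linarith
  have hlt := lt_decay_exponents hp1 hpq (by linarith) hpn hδ hμ rfl hD hineq
  obtain ⟨A, hA, huA⟩ := h.exists_le_rpow h' hp1 hq1 (by linarith) hpn hqn hδ hμ rfl hD
  obtain ⟨B, hB, hvB⟩ := h'.exists_le_rpow h hq1 hp1 (by linarith) hqn hpn hμ hδ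
    (D := δ * μ - (p - 1) * (q - 1)) (by ring) hD
  have hkn : (n - p) / (p - 1) = (n - 1) / (p - 1) - 1 := by field_simp; ring
  have hlk : (n - 1) / (q - 1) ≤ (n - 1) / (p - 1) := by
    gcongr; linarith
  have hkn' : (n - 1) / (p - 1) - 1 < n := by
    rw [← hkn, div_lt_iff₀ hp0]
    rw [div_lt_iff₀ (by linarith)] at hp
    linarith
  have hineq' : (n - 1) / (p - 1) - 1 < n / (δ + 1) + n / (μ + 1) := by
    rw [← hkn]
    calc (n - p) / (p - 1) = n * ((n - p) / (n * (p - 1))) := by field_simp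
      _ < _ := mul_lt_mul_of_pos_left hineq hn0
      _ = _ := by ring
  have hVv := h'.mul_slope_le h.pos hq1 one_pos hqn
  rw [hkn] at hlt
  generalize (p * (q - 1) + q * δ) / (δ * μ - (p - 1) * (q - 1)) = α at hlt huA
  generalize (q * (p - 1) + p * μ) / (δ * μ - (p - 1) * (q - 1)) = β at hlt hvB
  obtain ⟨k, hk⟩ : ∃ k, (n - 1) / (p - 1) = k := ⟨_, rfl⟩
  obtain ⟨l, hl⟩ : ∃ l, (n - 1) / (q - 1) = l := ⟨_, rfl⟩
  rw [hk] at hlt hlk hkn' hineq'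
  rw [hl] at hlk hVv
  have hl1 : 0 < l - 1 := by
    by_contra! hneg
    nlinarith [h'.slope_pos 1 one_pos, mul_nonneg (sub_nonneg.2 hneg) (h'.pos 1 one_pos).le]
  have hd : 0 ≤ k - l := sub_nonneg.2 hlk
  obtain ⟨a, ha⟩ : ∃ a, a = (n - (k - l)) / (δ + 1) := ⟨_, rfl⟩
  obtain ⟨b, hb⟩ : ∃ b, b = n / (μ + 1) := ⟨_, rfl⟩
  have ha0 : 0 ≤ a := by rw [ha]; apply div_nonneg <;> linarith
  have hb0 : 0 ≤ b := by rw [hb]; positivity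
  have hcoef : 0 < (1 - k + a + b) * (l - 1) + a * (k - l) := by
    have h1 : n / (δ + 1) * (l - 1) ≤ a * (l - 1) + a * (k - l) := by
      rw [ha, ← mul_add, div_mul_eq_mul_div, div_mul_eq_mul_div]
      refine div_le_div_of_nonneg_right ?_ (by linarith)
      nlinarith [mul_nonneg hd (sub_nonneg.2 hkn'.le)]
    have h2 : 0 < (1 - k + n / (δ + 1) + b) * (l - 1) := by
      rw [hb]; apply mul_pos _ hl1; linarith
    linarith
  have hmono := h.strictMonoOn_energy h' hp1 hq1 (by linarith) hq2 hδ hμ hk hl hl1 hd ha0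
    (by rw [ha]; field_simp) (by rw [hb]; field_simp) hcoef
  obtain ⟨C, hC⟩ := h.exists_energy_lower h' hp1 hq1 hδ hμ ha0 hb0 (l := l)
  obtain ⟨c, hc0, hc⟩ := h.exists_energy_le h' hp1 hq1 (by linarith) hq2 hn hδ hμ ha0 hb0 (l := l)
  have hpos := pos_of_strictMonoOn_Ioi hmono (by linarith) hC one_pos
  have hγ : 0 < α + β - (l - 1) := by linarith
  have hupper : ∀ r, 1 ≤ r →
      energy p q δ μ l a b u U v V 1 ≤ c * (A * B) * r ^ (-(α + β - (l - 1))) := by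
    intro r hr1
    have hr : 0 < r := by linarith
    have hu := h.pos r hr
    have hv := h'.pos r hr
    refine (hmono.monotoneOn (mem_Ioi.2 one_pos) hr hr1).trans ((hc r hr).trans ?_)
    calc c * (r ^ (l - 1) * (u r * v r))
      _ ≤ c * (r ^ (l - 1) * ((A * r ^ (-α)) * (B * r ^ (-β)))) := by
          gcongr
          · exact huA r hr
          · exact hvB r hr
      _ = c * (A * B) * (r ^ (l - 1) * r ^ (-α) * r ^ (-β)) := by ring
      _ = _ := by
          rw [← Real.rpow_add hr, ← Real.rpow_add hr]
          congr 2; ring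
  have hlim : Tendsto (fun r : ℝ => c * (A * B) * r ^ (-(α + β - (l - 1)))) atTop (𝓝 0) := by
    simpa using (tendsto_rpow_neg_atTop hγ).const_mul (c * (A * B))
  exact hpos.not_ge (ge_of_tendsto hlim ((eventually_ge_atTop 1).mono hupper))

/-- Positive solutions of the radial equation in flux form are decreasing. -/
theorem of_deriv_flux (hn : 1 < n) (hp : 1 < p) (hu1 : ContDiffOn ℝ 1 u (Ici 0))
    (hu2 : ContDiffOn ℝ 2 u (Ioi 0)) (hu : ∀ r, 0 ≤ r → 0 < u r) (hv : ∀ r, 0 ≤ r → 0 < v r)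
    (heq : ∀ r, 0 < r → deriv (fun s => s ^ (n - 1) * |deriv u s| ^ (p - 2) * deriv u s) r
      = -(r ^ (n - 1) * v r ^ δ)) :
    IsDecreasingSolution n p δ u (fun r => -deriv u r) v := by
  have hp0 : 0 < p - 1 := by linarith
  obtain ⟨M, hM⟩ : ∃ M, ∀ r ∈ Icc (0 : ℝ) 1, ‖derivWithin u (Ici 0) r‖ ≤ M :=
    isCompact_Icc.exists_bound_of_continuousOn
      ((hu1.continuousOn_derivWithin (uniqueDiffOn_Ici 0) le_rfl).mono Icc_subset_Ici_self)
  obtain ⟨M₀, hM₀⟩ : ∃ M, ∀ r ∈ Icc (0 : ℝ) 1, ‖u r‖ ≤ M :=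
    isCompact_Icc.exists_bound_of_continuousOn (hu1.continuousOn.mono Icc_subset_Ici_self)
  have hM' : ∀ r, 0 < r → r ≤ 1 → |deriv u r| ≤ M := fun r hr hr1 => by
    rw [← derivWithin_of_mem_nhds (Ici_mem_nhds hr)]
    exact hM r ⟨hr.le, hr1⟩
  have hsource : ∀ r, 0 < r → 0 < r ^ (n - 1) * v r ^ δ := fun r hr => by
    have := hv r hr.le
    positivity
  have hflux : ∀ r, 0 < r → HasDerivAt
      (fun s => -(s ^ (n - 1) * |deriv u s| ^ (p - 2) * deriv u s)) (r ^ (n - 1) * v r ^ δ) r := by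
    intro r hr
    have hd : DifferentiableAt ℝ (fun s => s ^ (n - 1) * |deriv u s| ^ (p - 2) * deriv u s) r := by
      refine differentiableAt_of_deriv_ne_zero ?_
      rw [heq r hr]
      exact (neg_neg_of_pos (hsource r hr)).ne
    refine hd.hasDerivAt.fun_neg.congr_deriv ?_
    rw [heq r hr, neg_neg]
  have habs : ∀ x : ℝ, |x| ^ (p - 2) * |x| = |x| ^ (p - 1) := fun x => by
    rcases (abs_nonneg x).eq_or_lt with h0 | h0
    · rw [← h0, mul_zero, Real.zero_rpow hp0.ne']
    · rw [← Real.rpow_add_one h0.ne']; congr 1; ring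
  have hneg : ∀ r, 0 < r → deriv u r < 0 := by
    intro r hr
    have h1 := pos_of_strictMonoOn_Ioi (strictMonoOn_Ioi_of_hasDerivAt hflux hsource)
      (C := M ^ (p - 1)) (a := n - 1) (by linarith) (fun s hs hs1 => by
        have h2 : |deriv u s| ^ (p - 1) ≤ M ^ (p - 1) :=
          Real.rpow_le_rpow (abs_nonneg _) (hM' s hs hs1) hp0.le
        have h3 : 0 ≤ s ^ (n - 1) := by positivity
        have h4 : s ^ (n - 1) * |deriv u s| ^ (p - 2) * deriv u s
            ≤ s ^ (n - 1) * |deriv u s| ^ (p - 2) * |deriv u s| := by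
          gcongr; exact le_abs_self _
        rw [mul_assoc (s ^ (n - 1)) _ (|deriv u s|), habs] at h4
        nlinarith [mul_le_mul_of_nonneg_left h2 h3]) hr
    by_contra! hge
    have : 0 ≤ r ^ (n - 1) * |deriv u r| ^ (p - 2) * deriv u r := by positivity
    linarith
  have hdiff : ∀ r, 0 < r → DifferentiableAt ℝ u r := fun r hr =>
    (hu2.differentiableOn (by norm_num)).differentiableAt (Ioi_mem_nhds hr)
  have hdiff' : ∀ r, 0 < r → DifferentiableAt ℝ (deriv u) r := fun r hr =>
    ((hu2.deriv_of_isOpen (m := 1) isOpen_Ioi (by norm_num)).differentiableOn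
      (by norm_num)).differentiableAt (Ioi_mem_nhds hr)
  refine ⟨fun r hr => hu r hr.le, fun r hr => neg_pos.2 (hneg r hr), fun r hr => ?_,
    fun r hr => ?_, max M₀ M, fun r hr hr1 => ⟨?_, ?_⟩⟩
  · simpa using (hdiff r hr).hasDerivAt
  · have hU : 0 < -deriv u r := neg_pos.2 (hneg r hr)
    have hd := (hdiff' r hr).hasDerivAt.fun_neg
    have h1 := (Real.hasDerivAt_rpow_const (p := n - 1) (Or.inl hr.ne')).fun_mul
      (hd.rpow_const (p := p - 1) (Or.inl hU.ne'))
    have h2 : (fun s => s ^ (n - 1) * (-deriv u s) ^ (p - 1)) =ᶠ[𝓝 r]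
        fun s => -(s ^ (n - 1) * |deriv u s| ^ (p - 2) * deriv u s) := by
      filter_upwards [Ioi_mem_nhds hr] with s hs
      rw [← abs_of_neg (hneg s hs), ← habs, abs_of_neg (hneg s hs)]
      ring
    have h3 := h1.unique ((hflux r hr).congr_of_eventuallyEq h2)
    refine hd.congr_deriv ?_
    set W := -deriv u r
    have e1 : W ^ (p - 1) = W * W ^ (p - 1 - 1) := by
      rw [mul_comm, ← Real.rpow_add_one hU.ne']; congr 1; ring
    have e2 : W ^ (2 - p) * W ^ (p - 1 - 1) = 1 := by
      rw [← Real.rpow_add hU]; ring_nf; simp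
    have e3 : r ^ (n - 1) = r * r ^ (n - 1 - 1) := by
      rw [mul_comm, ← Real.rpow_add_one hr.ne']; congr 1; ring
    have hX : 0 < r ^ (n - 1 - 1) := by positivity
    rw [e1, e3] at h3
    set X := r ^ (n - 1 - 1)
    set Y := W ^ (p - 1 - 1)
    set Z := W ^ (2 - p)
    set S := deriv (deriv u) r
    have h4 : (n - 1) * (W * Y) + r * (-S * (p - 1) * Y) = r * v r ^ δ := by
      refine mul_left_cancel₀ hX.ne' ?_
      linear_combination h3
    field_simp
    linear_combination Z * h4 + (-(n - 1) * W + r * (p - 1) * S) * e2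
  · exact (le_abs_self _).trans ((hM₀ r ⟨hr.le, hr1⟩).trans (le_max_left _ _))
  · exact (neg_le_abs _).trans ((hM' r hr hr1).trans (le_max_right _ _))

end IsDecreasingSolution

/-- Nonexistence of radial ground states of (S_∞) in the subquadratic case. -/
theorem no_groundstate_subquadratic (N : ℕ) (hN : 2 ≤ N) (p q δ μ : ℝ)
    (hδ : 0 < δ) (hμ : 0 < μ) (hH1 : 0 < δ * μ - (p - 1) * (q - 1))
    (hp1 : 2 * (N : ℝ) / (N + 1) < p) (hp2 : p ≤ 2)
    (hq1 : 2 * (N : ℝ) / (N + 1) < q) (hq2 : q ≤ 2)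
    (hineq : 1 / (δ + 1) + 1 / (μ + 1) > ((N : ℝ) - min p q) / (N * (min p q - 1))) :
    ¬ ∃ u v : ℝ → ℝ, IsGroundState N p q δ μ u v := by
  rintro ⟨u, v, hu1, hv1, hu2, hv2, hu, hv, -, -, heq, heq'⟩
  have hn : (2 : ℝ) ≤ N := by exact_mod_cast hN
  have hone : 1 ≤ 2 * (N : ℝ) / (N + 1) := by
    rw [le_div_iff₀ (by linarith)]; linarith
  have h := IsDecreasingSolution.of_deriv_flux (by linarith) (hone.trans_lt hp1) hu1 hu2 hu hv heq
  have h' := IsDecreasingSolution.of_deriv_flux (by linarith) (hone.trans_lt hq1) hv1 hv2 hv hu heq'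
  rcases le_total p q with hpq | hqp
  · rw [min_eq_left hpq] at hineq
    exact h.false_of_subcritical h' hn hδ hμ hH1 hp1 hpq hq2 hineq
  · rw [min_eq_right hqp] at hineq
    exact h'.false_of_subcritical h hn hμ hδ (by linarith) hq1 hqp hp2 (by linarith)
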